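/- Let u, v : ℝ × ℝ → ℝ be smooth functions of (x,t) solving the generalized Riemann equation at N=2, i.e. u_t = 2u·u_x − 2v and v_t = 2u·v_x, with v_x nowhere zero and v nowhere zero. Fix n ≥ 1 and let G : ℝ^{2n+1} → ℝ be any smooth function. Then the function F = (v_x/2)·G(v, α₁, β₁ − u·v^{−1}, α₂, β₂, …, α_n, β_n) satisfies the conservation law ∂_t F = ∂_x(2u·F) at every point. -/

import Mathlib

/-- Partial derivative with respect to the first variable `x`. -/
noncomputable def pdx (f : ℝ × ℝ → ℝ) (p : ℝ × ℝ) : ℝ := deriv (fun x => f (x, p.2)) p.1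

/-- Partial derivative with respect to the second variable `t`. -/
noncomputable def pdt (f : ℝ × ℝ → ℝ) (p : ℝ × ℝ) : ℝ := deriv (fun t => f (p.1, t)) p.2

open scoped ContDiff

section PartialDerivatives

variable {f g : ℝ × ℝ → ℝ}

lemma hasDerivAt_slice_fst (hf : Differentiable ℝ f) (p : ℝ × ℝ) :
    HasDerivAt (fun x => f (x, p.2)) (fderiv ℝ f p (1, 0)) p.1 :=
  (hf p).hasFDerivAt.comp_hasDerivAt (f := fun x => (x, p.2)) p.1
    ((hasDerivAt_id p.1).prodMk (hasDerivAt_const p.1 p.2))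

lemma hasDerivAt_slice_snd (hf : Differentiable ℝ f) (p : ℝ × ℝ) :
    HasDerivAt (fun t => f (p.1, t)) (fderiv ℝ f p (0, 1)) p.2 :=
  (hf p).hasFDerivAt.comp_hasDerivAt (f := fun t => (p.1, t)) p.2
    ((hasDerivAt_const p.2 p.1).prodMk (hasDerivAt_id p.2))

lemma pdx_eq_fderiv (hf : Differentiable ℝ f) (p : ℝ × ℝ) : pdx f p = fderiv ℝ f p (1, 0) :=
  (hasDerivAt_slice_fst hf p).deriv

lemma pdt_eq_fderiv (hf : Differentiable ℝ f) (p : ℝ × ℝ) : pdt f p = fderiv ℝ f p (0, 1) :=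
  (hasDerivAt_slice_snd hf p).deriv

lemma ContDiff.differentiable_of_infty {E F : Type*} [NormedAddCommGroup E] [NormedSpace ℝ E]
    [NormedAddCommGroup F] [NormedSpace ℝ F] {f : E → F} (hf : ContDiff ℝ ∞ f) :
    Differentiable ℝ f :=
  hf.differentiable (by simp)

lemma ContDiff.pdx (hf : ContDiff ℝ ∞ f) : ContDiff ℝ ∞ (_root_.pdx f) := by
  rw [funext (pdx_eq_fderiv hf.differentiable_of_infty)]
  exact (hf.fderiv_right (m := ∞) (by simp)).clm_apply contDiff_const

lemma pdt_pdx (hf : ContDiff ℝ ∞ f) (p : ℝ × ℝ) : pdt (pdx f) p = pdx (pdt f) p := by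
  have hd : ContDiff ℝ ∞ (fderiv ℝ f) := hf.fderiv_right (m := ∞) (by simp)
  have hdd := hd.differentiable_of_infty
  rw [funext (pdx_eq_fderiv hf.differentiable_of_infty),
    funext (pdt_eq_fderiv hf.differentiable_of_infty),
    pdt_eq_fderiv (hd.clm_apply contDiff_const).differentiable_of_infty,
    pdx_eq_fderiv (hd.clm_apply contDiff_const).differentiable_of_infty,
    fderiv_clm_apply (hdd p) (differentiableAt_const _),
    fderiv_clm_apply (hdd p) (differentiableAt_const _)]
  have hsymm : IsSymmSndFDerivAt ℝ f p := hf.contDiffAt.isSymmSndFDerivAt (by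
    simpa using WithTop.coe_le_coe.2 (le_top : (2 : ℕ∞) ≤ ⊤))
  simpa using hsymm.eq (0, 1) (1, 0)

lemma pdx_mul (hf : Differentiable ℝ f) (hg : Differentiable ℝ g) (p : ℝ × ℝ) :
    pdx (fun q => f q * g q) p = pdx f p * g p + f p * pdx g p := by
  rw [pdx_eq_fderiv hf, pdx_eq_fderiv hg]
  exact ((hasDerivAt_slice_fst hf p).mul (hasDerivAt_slice_fst hg p)).deriv

lemma pdt_mul (hf : Differentiable ℝ f) (hg : Differentiable ℝ g) (p : ℝ × ℝ) :
    pdt (fun q => f q * g q) p = pdt f p * g p + f p * pdt g p := by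
  rw [pdt_eq_fderiv hf, pdt_eq_fderiv hg]
  exact ((hasDerivAt_slice_snd hf p).mul (hasDerivAt_slice_snd hg p)).deriv

lemma pdx_sub (hf : Differentiable ℝ f) (hg : Differentiable ℝ g) (p : ℝ × ℝ) :
    pdx (fun q => f q - g q) p = pdx f p - pdx g p := by
  rw [pdx_eq_fderiv hf, pdx_eq_fderiv hg]
  exact ((hasDerivAt_slice_fst hf p).sub (hasDerivAt_slice_fst hg p)).deriv

lemma pdt_sub (hf : Differentiable ℝ f) (hg : Differentiable ℝ g) (p : ℝ × ℝ) :
    pdt (fun q => f q - g q) p = pdt f p - pdt g p := by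
  rw [pdt_eq_fderiv hf, pdt_eq_fderiv hg]
  exact ((hasDerivAt_slice_snd hf p).sub (hasDerivAt_slice_snd hg p)).deriv

@[simp] lemma pdx_const (c : ℝ) (p : ℝ × ℝ) : pdx (fun _ => c) p = 0 := by simp [pdx]

@[simp] lemma pdt_const (c : ℝ) (p : ℝ × ℝ) : pdt (fun _ => c) p = 0 := by simp [pdt]

end PartialDerivatives

section Transport

variable {u v f g : ℝ × ℝ → ℝ}

/-- The function `f` has constant rate of change `c` along the flow of `∂_t - 2 u ∂_x`. -/
def IsTransported (u : ℝ × ℝ → ℝ) (c : ℝ) (f : ℝ × ℝ → ℝ) : Prop :=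
  ∀ p, pdt f p = 2 * u p * pdx f p + c

lemma IsTransported.fderiv_apply (hf : Differentiable ℝ f) (h : IsTransported u 0 f)
    (p : ℝ × ℝ) : fderiv ℝ f p (-(2 * u p), 1) = 0 := by
  have hw : ((-(2 * u p), 1) : ℝ × ℝ) = (-(2 * u p)) • (1, 0) + (0, 1) := by simp
  rw [hw, map_add, map_smul, ← pdx_eq_fderiv hf, ← pdt_eq_fderiv hf, h p, smul_eq_mul]
  ring

lemma isTransported_zero_iff (hf : Differentiable ℝ f) :
    IsTransported u 0 f ↔ ∀ p, fderiv ℝ f p (-(2 * u p), 1) = 0 := by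
  refine ⟨fun h p => h.fderiv_apply hf p, fun h p => ?_⟩
  have hw : ((-(2 * u p), 1) : ℝ × ℝ) = (-(2 * u p)) • (1, 0) + (0, 1) := by simp
  have hp := h p
  rw [hw, map_add, map_smul, ← pdx_eq_fderiv hf, ← pdt_eq_fderiv hf, smul_eq_mul] at hp
  linarith

lemma IsTransported.comp {ι : Type*} [Fintype ι] {G : (ι → ℝ) → ℝ} {Φ : ι → ℝ × ℝ → ℝ}
    (hG : Differentiable ℝ G) (hΦ : ∀ i, Differentiable ℝ (Φ i))
    (h : ∀ i, IsTransported u 0 (Φ i)) : IsTransported u 0 (fun q => G (fun i => Φ i q)) := by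
  have hΦ' : Differentiable ℝ (fun q i => Φ i q) := differentiable_pi.2 hΦ
  refine (isTransported_zero_iff (hG.comp hΦ')).2 fun p => ?_
  have hcomp := (hG (fun i => Φ i p)).hasFDerivAt.comp p
    (hasFDerivAt_pi.2 fun i => (hΦ i p).hasFDerivAt)
  have hzero : ContinuousLinearMap.pi (fun i => fderiv ℝ (Φ i) p) (-(2 * u p), 1) = 0 := by
    ext i
    exact (h i).fderiv_apply (hΦ i) p
  rw [hcomp.fderiv, ContinuousLinearMap.comp_apply, hzero, map_zero]

lemma IsTransported.pdt_pdx_eq {c : ℝ} (hu : ContDiff ℝ ∞ u) (hf : ContDiff ℝ ∞ f)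
    (h : IsTransported u c f) (p : ℝ × ℝ) :
    pdt (pdx f) p = 2 * pdx u p * pdx f p + 2 * u p * pdx (pdx f) p := by
  have hu' := hu.differentiable_of_infty
  have heq : pdt f = fun q => (2 * u q) * pdx f q - (-c) := by
    ext q
    rw [h q, sub_neg_eq_add]
  rw [pdt_pdx hf, heq,
    pdx_sub ((hu'.const_mul 2).fun_mul hf.pdx.differentiable_of_infty) (differentiable_const _),
    pdx_mul (hu'.const_mul 2) hf.pdx.differentiable_of_infty,
    pdx_mul (differentiable_const _) hu']
  simp

/-- Dividing `∂_x` by `v_x` for a transported `v` gives a derivation commuting with the flow. -/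
lemma IsTransported.inv_mul_pdx {c : ℝ} (hu : ContDiff ℝ ∞ u) (hv : ContDiff ℝ ∞ v)
    (hvt : IsTransported u 0 v) (hvx : ∀ p, pdx v p ≠ 0) (hf : ContDiff ℝ ∞ f)
    (h : IsTransported u c f) (hg : Differentiable ℝ g)
    (hgf : ∀ p, g p = (pdx v p)⁻¹ * pdx f p) : IsTransported u 0 g := by
  intro p
  have hfx : pdx f = fun q => pdx v q * g q := by
    ext q
    rw [hgf q, mul_inv_cancel_left₀ (hvx q)]
  have hvd := hv.pdx.differentiable_of_infty
  have hfxt := h.pdt_pdx_eq hu hf p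
  rw [hfx, pdt_mul hvd hg, pdx_mul hvd hg, hvt.pdt_pdx_eq hu hv p] at hfxt
  apply mul_left_cancel₀ (hvx p)
  linear_combination hfxt

end Transport

theorem riemannN2_conserved_density_general (u v : ℝ × ℝ → ℝ)
    (hu : ContDiff ℝ (⊤ : ℕ∞) u) (hv : ContDiff ℝ (⊤ : ℕ∞) v)
    (hequ : ∀ p : ℝ × ℝ, pdt u p = 2 * u p * pdx u p - 2 * v p)
    (heqv : ∀ p : ℝ × ℝ, pdt v p = 2 * u p * pdx v p)
    (hvx : ∀ p : ℝ × ℝ, pdx v p ≠ 0)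
    (hv0 : ∀ p : ℝ × ℝ, v p ≠ 0)
    (n : ℕ) (hn : 1 ≤ n)
    (G : (Fin (2 * n + 1) → ℝ) → ℝ) (hG : ContDiff ℝ (⊤ : ℕ∞) G)
    (α β : ℕ → ℝ × ℝ → ℝ)
    (hα1 : ∀ p : ℝ × ℝ, α 1 p = (pdx u p) ^ 2 * ((pdx v p) ^ 2)⁻¹ - 2 * (pdx v p)⁻¹)
    (hβ1 : ∀ p : ℝ × ℝ, β 1 p = pdx u p * (pdx v p)⁻¹)
    (hαrec : ∀ k, 1 ≤ k → ∀ p : ℝ × ℝ, α (k + 1) p = (pdx v p)⁻¹ * pdx (α k) p)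
    (hβrec : ∀ k, 1 ≤ k → ∀ p : ℝ × ℝ, β (k + 1) p = (pdx v p)⁻¹ * pdx (β k) p) :
    ∀ p : ℝ × ℝ,
      pdt (fun q => pdx v q / 2 *
      G (fun i => if i.val = 0 then v q
          else if i.val = 1 then α 1 q
          else if i.val = 2 then β 1 q - u q * (v q)⁻¹
          else if i.val % 2 = 1 then α ((i.val + 1) / 2) q
          else β (i.val / 2) q)) p
        = pdx (fun q => 2 * u q * ((fun q => pdx v q / 2 *
      G (fun i => if i.val = 0 then v q
          else if i.val = 1 then α 1 q
          else if i.val = 2 then β 1 q - u q * (v q)⁻¹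
          else if i.val % 2 = 1 then α ((i.val + 1) / 2) q
          else β (i.val / 2) q)) q)) p := by
  have hvt : IsTransported u 0 v := fun p => by rw [heqv p, add_zero]
  have hud := hu.differentiable_of_infty
  have hvd := hv.differentiable_of_infty
  have huxd := hu.pdx.differentiable_of_infty
  have hvxd := hv.pdx.differentiable_of_infty
  have hvxt := hvt.pdt_pdx_eq hu hv
  have huxt (p : ℝ × ℝ) : pdt (pdx u) p
      = 2 * pdx u p ^ 2 + 2 * u p * pdx (pdx u) p - 2 * pdx v p := by
    rw [pdt_pdx hu, funext hequ, pdx_sub ((hud.const_mul 2).fun_mul huxd) (hvd.const_mul 2),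
      pdx_mul (hud.const_mul 2) huxd, pdx_mul (differentiable_const _) hud,
      pdx_mul (differentiable_const _) hvd, pdx_const]
    ring
  have hβ1c : ContDiff ℝ ∞ (β 1) := by
    rw [funext hβ1]
    exact hu.pdx.mul (hv.pdx.inv hvx)
  have hα1c : ContDiff ℝ ∞ (α 1) := by
    rw [funext hα1]
    exact ((hu.pdx.pow 2).mul ((hv.pdx.pow 2).inv fun p => pow_ne_zero 2 (hvx p))).sub
      (contDiff_const.mul (hv.pdx.inv hvx))
  have hβ1t : IsTransported u (-2) (β 1) := by
    intro p
    have hux : pdx u = fun q => pdx v q * β 1 q := by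
      ext q
      rw [hβ1 q]
      field_simp [hvx q]
    have hb := hβ1c.differentiable_of_infty
    have key := huxt p
    have hxx : pdx (pdx u) p = pdx (pdx v) p * β 1 p + pdx v p * pdx (β 1) p := by
      conv_lhs => rw [hux]
      exact pdx_mul hvxd hb p
    have hxt : pdt (pdx u) p = pdt (pdx v) p * β 1 p + pdx v p * pdt (β 1) p := by
      conv_lhs => rw [hux]
      exact pdt_mul hvxd hb p
    have hp : pdx u p = pdx v p * β 1 p := congrFun hux p
    rw [hxx, hxt, hvxt p] at key
    apply mul_left_cancel₀ (hvx p)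
    linear_combination key + 2 * pdx u p * hp
  have hα1t : IsTransported u 0 (α 1) := by
    intro p
    have hux (q : ℝ × ℝ) : pdx u q = pdx v q * β 1 q := by
      rw [hβ1 q]
      field_simp [hvx q]
    have hb := hβ1c.differentiable_of_infty
    have ha := hα1c.differentiable_of_infty
    have heq : (fun q => pdx v q * α 1 q) = fun q => pdx u q * β 1 q - 2 := by
      ext q
      rw [hα1 q, hβ1 q]
      field_simp [hvx q]
    have hx := congrArg (fun F => pdx F p) heq
    have ht := congrArg (fun F => pdt F p) heq
    have h0 := congrFun heq p
    simp only [pdx_sub (huxd.fun_mul hb) (differentiable_const _), pdx_mul hvxd ha,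
      pdx_mul huxd hb, pdx_const] at hx
    simp only [pdt_sub (huxd.fun_mul hb) (differentiable_const _), pdt_mul hvxd ha,
      pdt_mul huxd hb, pdt_const, hvxt p, huxt p, hβ1t p] at ht
    apply mul_left_cancel₀ (hvx p)
    linear_combination ht - 2 * u p * hx - 2 * pdx u p * h0 + 2 * hux p
  have hwd : Differentiable ℝ (fun q => u q * (v q)⁻¹) := hud.mul (hvd.inv hv0)
  have hwt : IsTransported u (-2) (fun q => u q * (v q)⁻¹) := by
    intro p
    have heq : u = fun q => v q * (u q * (v q)⁻¹) := by
      ext q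
      field_simp [hv0 q]
    have hx : pdx u p = _ := (congrArg (fun F => pdx F p) heq).trans (pdx_mul hvd hwd p)
    have ht : pdt u p = _ := (congrArg (fun F => pdt F p) heq).trans (pdt_mul hvd hwd p)
    rw [hequ p, heqv p] at ht
    apply mul_left_cancel₀ (hv0 p)
    linear_combination 2 * u p * hx - ht
  have hαc (k : ℕ) (hk : 1 ≤ k) : ContDiff ℝ ∞ (α k) ∧ IsTransported u 0 (α k) := by
    induction k, hk using Nat.le_induction with
    | base => exact ⟨hα1c, hα1t⟩
    | succ k hk ih =>
      have hc : ContDiff ℝ ∞ (α (k + 1)) := by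
        rw [funext (hαrec k hk)]
        exact (hv.pdx.inv hvx).mul ih.1.pdx
      exact ⟨hc, hvt.inv_mul_pdx hu hv hvx ih.1 ih.2 hc.differentiable_of_infty (hαrec k hk)⟩
  have hβc (k : ℕ) (hk : 1 ≤ k) : ContDiff ℝ ∞ (β k) ∧ ∃ c, IsTransported u c (β k) ∧
      (2 ≤ k → c = 0) := by
    induction k, hk using Nat.le_induction with
    | base => exact ⟨hβ1c, -2, hβ1t, by simp⟩
    | succ k hk ih =>
      obtain ⟨ihc, c, iht, -⟩ := ih
      have hc : ContDiff ℝ ∞ (β (k + 1)) := by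
        rw [funext (hβrec k hk)]
        exact (hv.pdx.inv hvx).mul ihc.pdx
      exact ⟨hc, 0, hvt.inv_mul_pdx hu hv hvx ihc iht hc.differentiable_of_infty (hβrec k hk),
        fun _ => rfl⟩
  have harg (i : ℕ) : Differentiable ℝ (fun q => if i = 0 then v q
          else if i = 1 then α 1 q
          else if i = 2 then β 1 q - u q * (v q)⁻¹
          else if i % 2 = 1 then α ((i + 1) / 2) q
          else β (i / 2) q) ∧ IsTransported u 0 (fun q => if i = 0 then v q
          else if i = 1 then α 1 q
          else if i = 2 then β 1 q - u q * (v q)⁻¹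
          else if i % 2 = 1 then α ((i + 1) / 2) q
          else β (i / 2) q) := by
    split_ifs with h0 h1 h2 h3
    · exact ⟨hvd, hvt⟩
    · exact ⟨hα1c.differentiable_of_infty, hα1t⟩
    · have hb := hβ1c.differentiable_of_infty
      refine ⟨hb.sub hwd, fun p => ?_⟩
      rw [pdt_sub hb hwd, pdx_sub hb hwd, hβ1t p, hwt p]
      ring
    · obtain ⟨hc, ht⟩ := hαc ((i + 1) / 2) (by omega)
      exact ⟨hc.differentiable_of_infty, ht⟩
    · obtain ⟨hc, c, ht, hc0⟩ := hβc (i / 2) (by omega)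
      rw [hc0 (by omega)] at ht
      exact ⟨hc.differentiable_of_infty, ht⟩
  intro p
  have hGt := IsTransported.comp (u := u) hG.differentiable_of_infty
    (fun i : Fin (2 * n + 1) => (harg i.val).1) (fun i => (harg i.val).2)
  have hGd := hG.differentiable_of_infty.comp
    (differentiable_pi.2 fun i : Fin (2 * n + 1) => (harg i.val).1)
  unfold Function.comp at hGd
  have hhalf : Differentiable ℝ (fun q => pdx v q / 2) := by
    simpa only [div_eq_mul_inv] using hvxd.mul_const (2 : ℝ)⁻¹
  have hhx : pdx (fun q => pdx v q / 2) p = pdx (pdx v) p / 2 := by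
    simp only [div_eq_mul_inv]
    rw [pdx_mul hvxd (differentiable_const _)]
    simp
  have hht : pdt (fun q => pdx v q / 2) p = pdt (pdx v) p / 2 := by
    simp only [div_eq_mul_inv]
    rw [pdt_mul hvxd (differentiable_const _)]
    simp
  have h2u : pdx (fun q => 2 * u q) p = 2 * pdx u p := by
    rw [pdx_mul (differentiable_const _) hud]
    simp
  rw [pdt_mul hhalf hGd, pdx_mul (hud.const_mul 2) (hhalf.fun_mul hGd), pdx_mul hhalf hGd, hGt p,
    hhx, hht, h2u, hvxt p]
  ring
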